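/- arXiv:2207.04232 — 4 statements merged into one kernel-verified Lean document; each statement's English description precedes it below -/
import Mathlib

section
/- Let q = r^m with r an odd prime power and m a positive integer, and let F_q be the finite field with q elements. Let V = {v_1, …, v_{r^e}} be an e-dimensional F_r-vector subspace of F_q with 0 ≤ e ≤ m−1. Let t be an even integer with 1 ≤ t ≤ r−1, let β_1, …, β_t be distinct elements of F_r, and let ζ ∈ F_q \ V. Set α_{ij} = β_i ζ + v_j for 1 ≤ i ≤ t, 1 ≤ j ≤ r^e, so that the α_{ij} are t·r^e distinct elements of F_q. Then there exists λ ∈ F_q^* such that for all i, j, η(λ · ∏_{(k,l) ≠ (i,j)} (α_{ij} − α_{kl})) = η(∏_{k ≠ i} (β_i − β_k)). -/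
open Finset

/-- The Euclidean dual of a linear code `C ⊆ F^n`. -/
def euclideanDual {F : Type*} [Field F] {n : ℕ} (C : Submodule F (Fin n → F)) :
    Submodule F (Fin n → F) where
  carrier := {x | ∀ c ∈ C, ∑ i, x i * c i = 0}
  add_mem' := by
    intro a b ha hb c hc
    have h : ∑ i, (a + b) i * c i = (∑ i, a i * c i) + ∑ i, b i * c i := by
      rw [← Finset.sum_add_distrib]
      exact Finset.sum_congr rfl fun i _ => by simp [add_mul]
    simp only [Set.mem_setOf_eq] at *
    rw [h, ha c hc, hb c hc, add_zero]
  zero_mem' := by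
    intro c hc
    simp
  smul_mem' := by
    intro r a ha c hc
    have h : ∑ i, (r • a) i * c i = r * ∑ i, a i * c i := by
      rw [Finset.mul_sum]
      exact Finset.sum_congr rfl fun i _ => by simp [mul_assoc]
    simp only [Set.mem_setOf_eq] at *
    rw [h, ha c hc, mul_zero]

/-- Hamming weight of a word. -/
noncomputable def hWeight {F : Type*} [Field F] {n : ℕ} (c : Fin n → F) : ℕ := Nat.card {i : Fin n // c i ≠ 0}

/-- `C` is an MDS (Euclidean) self-dual code: it equals its Euclidean dual and its
minimum Hamming distance is `n/2 + 1`. -/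
def IsMDSSelfDual {F : Type*} [Field F] {n : ℕ} (C : Submodule F (Fin n → F)) : Prop :=
  C = euclideanDual C ∧
  (∀ c ∈ C, c ≠ 0 → n / 2 + 1 ≤ hWeight c) ∧
  (∃ c ∈ C, c ≠ 0 ∧ hWeight c = n / 2 + 1)

open Classical in
/-- The quadratic character `η` of a field: `1` on nonzero squares, `-1` on nonsquares,
`0` at `0`. -/
noncomputable def quadChar (F : Type*) [Field F] (x : F) : ℤ :=
  if x = 0 then 0 else if IsSquare x then 1 else -1

/-- Splitting a product over a punctured product type along the first coordinate. -/
theorem prod_erase_prodMk {ι κ M : Type*} [Fintype ι] [Fintype κ] [DecidableEq ι] [DecidableEq κ]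
    [CommMonoid M] (f : ι × κ → M) (i : ι) (j : κ) :
    ∏ x ∈ univ.erase (i, j), f x =
      (∏ l ∈ univ.erase j, f (i, l)) * ∏ k ∈ univ.erase i, ∏ l, f (k, l) := by
  have hdisj : Disjoint (({i} : Finset ι) ×ˢ univ.erase j) (univ.erase i ×ˢ (univ : Finset κ)) := by
    rw [Finset.disjoint_left]
    rintro ⟨a, b⟩ h
    simp only [mem_product, mem_singleton] at h
    simp [h.1]
  have hunion : univ.erase (i, j) =
      (({i} : Finset ι) ×ˢ univ.erase j).disjUnion (univ.erase i ×ˢ univ) hdisj := by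
    ext ⟨a, b⟩
    simp only [mem_erase, mem_univ, mem_disjUnion, mem_product, mem_singleton, Prod.mk.injEq,
      ne_eq, and_true]
    tauto
  rw [hunion, prod_disjUnion, prod_product, prod_product, prod_singleton]

/-- Translates of a subspace: the product of `b • ζ + u` over the subspace is, up to the factor
`b ^ |V|`, independent of `b ≠ 0`. -/
theorem Submodule.prod_algebraMap_mul_add {K F : Type*} [Field K] [Field F] [Algebra K F]
    (V : Submodule K F) [Fintype V] {b : K} (hb : b ≠ 0) (ζ : F) :
    ∏ u : V, (algebraMap K F b * ζ + u) =
      algebraMap K F b ^ Fintype.card V * ∏ u : V, (ζ + u) := by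
  rw [Fintype.card, ← prod_const, ← prod_mul_distrib]
  symm
  refine Fintype.prod_equiv (LinearEquiv.smulOfNeZero K V b hb).toEquiv _ _ fun u => ?_
  simp [Algebra.smul_def, mul_add]

theorem stmt_0 (r m e t p k : ℕ) (hp : p.Prime) (hpodd : Odd p) (hr : r = p ^ k)
    (hk : 0 < k) (hm : 0 < m) (he : e ≤ m - 1)
    (K F : Type*) [Field K] [Field F] [Fintype K] [Fintype F] [Algebra K F]
    (hK : Fintype.card K = r) (hF : Fintype.card F = r ^ m)
    (V : Submodule K F) (hV : Module.finrank K V = e)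
    (ht : Even t) (ht1 : 1 ≤ t) (ht2 : t ≤ r - 1)
    (β : Fin t → K) (hβ : Function.Injective β)
    (ζ : F) (hζ : ζ ∉ V)
    (v : Fin (r ^ e) → F) (hv : Function.Injective v) (hvV : Set.range v = (V : Set F))
    (α : Fin t → Fin (r ^ e) → F)
    (hα : ∀ i j, α i j = algebraMap K F (β i) * ζ + v j) :
    Function.Injective (fun ij : Fin t × Fin (r ^ e) => α ij.1 ij.2) ∧
    ∃ lam : F, lam ≠ 0 ∧ ∀ (i : Fin t) (j : Fin (r ^ e)),
      quadChar F (lam * ∏ kl ∈ Finset.univ.erase (i, j), (α i j - α kl.1 kl.2)) =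
      quadChar F (algebraMap K F (∏ l ∈ Finset.univ.erase i, (β i - β l))) := by
  classical
  obtain ⟨w, hw⟩ : ∃ w : Fin (r ^ e) ≃ V, ∀ j, (w j : F) = v j :=
    ⟨(Equiv.ofInjective v hv).trans (Equiv.setCongr hvV), fun _ => rfl⟩
  have hnot : ∀ b : K, b ≠ 0 → ∀ u : V, algebraMap K F b * ζ + u ≠ 0 := by
    intro b hb u h
    refine hζ ((V.smul_mem_iff hb).1 ?_)
    rw [Algebra.smul_def, eq_neg_of_add_eq_zero_left h]
    exact V.neg_mem u.2
  have hdiff : ∀ i k j l, α i j - α k l =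
      algebraMap K F (β i - β k) * ζ + ((w j - w l : V) : F) := by
    intro i k j l
    rw [hα, hα, map_sub, Submodule.coe_sub, hw, hw]
    ring
  refine ⟨?_, ?_⟩
  · rintro ⟨i, j⟩ ⟨k, l⟩ h
    have h0 := sub_eq_zero.2 h
    simp only [hdiff] at h0
    obtain rfl : i = k := by
      by_contra hik
      exact hnot _ (sub_ne_zero.2 (hβ.ne hik)) _ h0
    rw [sub_self, map_zero, zero_mul, zero_add, Submodule.coe_eq_zero, sub_eq_zero] at h0
    rw [w.injective h0]
  have hcard : Fintype.card V = Fintype.card K ^ e := by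
    rw [Module.card_eq_pow_finrank (K := K), hV]
  have hA : (∏ u ∈ univ.erase (0 : V), (u : F)) ≠ 0 :=
    prod_ne_zero_iff.2 fun u hu => by simpa using hu
  have hB : (∏ u : V, (ζ + u)) ≠ 0 :=
    prod_ne_zero_iff.2 fun u _ => by simpa using hnot 1 one_ne_zero u
  have hrow : ∀ i j, ∏ l ∈ univ.erase j, (α i j - α i l) = ∏ u ∈ univ.erase (0 : V), (u : F) := by
    intro i j
    refine prod_equiv (w.trans (Equiv.subLeft (w j))) (fun l => ?_) fun l _ => ?_
    · simp [sub_eq_zero, eq_comm (a := j)]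
    · simp [hdiff]
  have hother : ∀ i k j, k ≠ i → ∏ l, (α i j - α k l) =
      algebraMap K F (β i - β k) * ∏ u : V, (ζ + u) := by
    intro i k j hki
    calc ∏ l, (α i j - α k l) = ∏ u : V, (algebraMap K F (β i - β k) * ζ + u) :=
          Fintype.prod_equiv (w.trans (Equiv.subLeft (w j))) _ _ fun l => by simp [hdiff]
      _ = _ := by
          rw [V.prod_algebraMap_mul_add (sub_ne_zero.2 (hβ.ne hki.symm)), hcard, ← map_pow,
            FiniteField.pow_card_pow]
  refine ⟨((∏ u ∈ univ.erase (0 : V), (u : F)) * (∏ u : V, (ζ + u)) ^ (t - 1))⁻¹,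
    inv_ne_zero (mul_ne_zero hA (pow_ne_zero _ hB)), fun i j => ?_⟩
  congr 1
  have hsplit : ∏ kl ∈ univ.erase (i, j), (α i j - α kl.1 kl.2) =
      (∏ u ∈ univ.erase (0 : V), (u : F)) * (∏ u : V, (ζ + u)) ^ (t - 1) *
        algebraMap K F (∏ l ∈ univ.erase i, (β i - β l)) := by
    rw [prod_erase_prodMk, hrow, prod_congr rfl fun k hk => hother i k j (ne_of_mem_erase hk),
      prod_mul_distrib, prod_const, card_erase_of_mem (mem_univ i), card_univ, Fintype.card_fin,
      map_prod]
    ring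
  rw [hsplit, inv_mul_cancel_left₀ (mul_ne_zero hA (pow_ne_zero (t - 1) hB))]
end

section
/- Let q = r^m where r is an odd prime power and m is a positive integer, and suppose q ≡ 1 (mod 4). Let e be an integer with 0 ≤ e ≤ m−1, and let t be a positive integer with 2t dividing r−1 and t ≠ (r−1)/2. Then there exists an MDS self-dual code over F_q of length 2t·r^e. -/
open Finset

open Polynomial

/-- The evaluation map of a generalized Reed-Solomon code with points `a` and multipliers `v`. -/
noncomputable def grsEval {F : Type*} [Field F] {n : ℕ} (a v : Fin n → F) :
    F[X] →ₗ[F] (Fin n → F) :=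
  LinearMap.pi fun i => v i • Polynomial.leval (a i)

lemma grsEval_apply {F : Type*} [Field F] {n : ℕ} (a v : Fin n → F) (f : F[X]) (i : Fin n) :
    grsEval a v f i = v i * f.eval (a i) := rfl

lemma hWeight_grsEval_add {F : Type*} [Field F] {n : ℕ} (a v : Fin n → F) (hv : ∀ i, v i ≠ 0)
    (f : F[X]) [DecidablePred fun i => f.eval (a i) = 0] :
    hWeight (grsEval a v f) + #{i | f.eval (a i) = 0} = n := by
  classical
  have h : hWeight (grsEval a v f) = #{i | ¬ f.eval (a i) = 0} := by
    rw [hWeight, Nat.card_eq_fintype_card, Fintype.card_subtype]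
    congr 1
    ext i
    simp [grsEval_apply, hv i]
  rw [h, add_comm, Finset.card_filter_add_card_filter_not, card_univ, Fintype.card_fin]

lemma card_zeros_le_natDegree {F : Type*} [Field F] {n : ℕ} {a : Fin n → F}
    (ha : Function.Injective a) {f : F[X]} (hf : f ≠ 0)
    [DecidablePred fun i => f.eval (a i) = 0] :
    #{i | f.eval (a i) = 0} ≤ f.natDegree := by
  classical
  rw [← Finset.card_image_of_injective _ ha]
  refine (Finset.card_le_card fun x hx => ?_).trans
    ((Multiset.toFinset_card_le f.roots).trans f.card_roots')
  obtain ⟨i, hi, rfl⟩ := Finset.mem_image.1 hx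
  simpa [hf] using hi

/-- A generalized Reed-Solomon code of length `2 * N` is self-dual if the squares of its
multipliers are proportional to the Lagrange weights of its points. -/
lemma exists_isMDSSelfDual_of_isSquare {F : Type*} [Field F] {n N : ℕ} (hN : 0 < N)
    (hn : n = 2 * N) (a : Fin n → F) (ha : Function.Injective a) (w : F) (hw : w ≠ 0)
    (h : ∀ i, IsSquare (w * ∏ j ∈ univ.erase i, (a i - a j))) :
    ∃ C : Submodule F (Fin n → F), IsMDSSelfDual C := by
  classical
  have hprod : ∀ i, ∏ j ∈ univ.erase i, (a i - a j) ≠ 0 := fun i =>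
    Finset.prod_ne_zero_iff.2 fun j hj =>
      sub_ne_zero.2 fun hij => (Finset.mem_erase.1 hj).1 (ha hij).symm
  choose s hs using h
  have hs0 : ∀ i, s i ≠ 0 := fun i hi => mul_ne_zero hw (hprod i) (by rw [hs i, hi, mul_zero])
  set v : Fin n → F := fun i => w / s i with hv
  have hv0 : ∀ i, v i ≠ 0 := fun i => div_ne_zero hw (hs0 i)
  have hvv : ∀ i, v i * v i = w / ∏ j ∈ univ.erase i, (a i - a j) := by
    intro i
    have := hprod i
    have := hs0 i
    simp only [hv]
    rw [div_mul_div_comm, ← hs i]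
    field_simp
  have key : ∀ f g : F[X], (f * g).degree < n →
      ∑ i, grsEval a v f i * grsEval a v g i = w * (f * g).coeff (n - 1) := by
    intro f g hfg
    have := Lagrange.coeff_eq_sum (s := univ) (v := a) ha.injOn (P := f * g) (by simpa using hfg)
    rw [card_univ, Fintype.card_fin] at this
    rw [this, Finset.mul_sum]
    refine Finset.sum_congr rfl fun i _ => ?_
    rw [grsEval_apply, grsEval_apply, mul_mul_mul_comm, hvv, eval_mul]
    ring
  refine ⟨(degreeLT F N).map (grsEval a v), le_antisymm ?_ ?_, ?_, ?_⟩
  · rintro _ ⟨f, hf, rfl⟩ _ ⟨g, hg, rfl⟩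
    have hdeg : (f * g).degree < ((n - 1 : ℕ) : WithBot ℕ) := by
      rcases eq_or_ne f 0 with rfl | hf0
      · simp
      rcases eq_or_ne g 0 with rfl | hg0
      · simp
      have h1 := (natDegree_lt_iff_degree_lt hf0).2 (mem_degreeLT.1 hf)
      have h2 := (natDegree_lt_iff_degree_lt hg0).2 (mem_degreeLT.1 hg)
      rw [← natDegree_lt_iff_degree_lt (mul_ne_zero hf0 hg0), natDegree_mul hf0 hg0]
      omega
    rw [key f g (hdeg.trans_le (by exact_mod_cast Nat.sub_le n 1)),
      coeff_eq_zero_of_degree_lt hdeg, mul_zero]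
  · intro x hx
    set f := Lagrange.interpolate univ a (fun i => x i / v i) with hf
    have hfx : grsEval a v f = x := by
      funext i
      rw [grsEval_apply, hf, Lagrange.eval_interpolate_at_node _ ha.injOn (mem_univ i),
        mul_div_cancel₀ _ (hv0 i)]
    have hfn : f.degree < n := by
      simpa only [card_univ, Fintype.card_fin] using
        Lagrange.degree_interpolate_lt (s := univ) (v := a) (fun i => x i / v i) ha.injOn
    refine ⟨f, mem_degreeLT.2 ?_, hfx⟩
    by_contra hlt
    have hf0 : f ≠ 0 := by
      rintro h0
      exact hlt (by rw [h0, degree_zero]; exact WithBot.bot_lt_coe _)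
    have hd1 : f.natDegree < n := (natDegree_lt_iff_degree_lt hf0).2 hfn
    have hd2 : N ≤ f.natDegree := by
      by_contra hc
      exact hlt ((natDegree_lt_iff_degree_lt hf0).1 (not_le.1 hc))
    have hXd : (f * X ^ (n - 1 - f.natDegree)).degree < (n : WithBot ℕ) := by
      rw [← natDegree_lt_iff_degree_lt (mul_ne_zero hf0 (pow_ne_zero _ X_ne_zero)),
        natDegree_mul_X_pow _ hf0]
      omega
    have h0 := hx (grsEval a v (X ^ (n - 1 - f.natDegree))) ⟨_, mem_degreeLT.2 (by
      rw [degree_X_pow]; exact_mod_cast (by omega)), rfl⟩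
    rw [← hfx, key _ _ hXd] at h0
    have hc : (f * X ^ (n - 1 - f.natDegree)).coeff (n - 1) = f.leadingCoeff := by
      conv_lhs => rw [show n - 1 = f.natDegree + (n - 1 - f.natDegree) by omega]
      rw [Nat.add_sub_cancel_left, coeff_mul_X_pow, leadingCoeff]
    rw [hc] at h0
    exact mul_ne_zero hw (leadingCoeff_ne_zero.2 hf0) h0
  · rintro _ ⟨f, hf, rfl⟩ hne
    have hf0 : f ≠ 0 := by rintro rfl; exact hne (map_zero _)
    have h1 := (natDegree_lt_iff_degree_lt hf0).2 (mem_degreeLT.1 hf)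
    have h2 := hWeight_grsEval_add a v hv0 f
    have h3 := card_zeros_le_natDegree ha hf0
    omega
  · obtain ⟨T, -, hT⟩ := Finset.exists_subset_card_eq
      (s := (univ : Finset (Fin n))) (n := N - 1) (by rw [card_univ, Fintype.card_fin]; omega)
    have hf0 : Lagrange.nodal T a ≠ 0 := Lagrange.nodal_ne_zero
    have hz : #{i | (Lagrange.nodal T a).eval (a i) = 0} = N - 1 := by
      rw [← hT]
      congr 1
      ext i
      simp [Lagrange.eval_nodal, Finset.prod_eq_zero_iff, sub_eq_zero, ha.eq_iff]
    have h2 := hWeight_grsEval_add a v hv0 (Lagrange.nodal T a)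
    have hwt : hWeight (grsEval a v (Lagrange.nodal T a)) = n / 2 + 1 := by omega
    refine ⟨_, ⟨_, mem_degreeLT.2 ?_, rfl⟩, ?_, hwt⟩
    · rw [Lagrange.degree_nodal, hT]
      exact_mod_cast (by omega)
    · intro h0
      rw [h0] at hwt
      simp [hWeight] at hwt

lemma exists_isMDSSelfDual_of_fintype {F ι : Type*} [Field F] [Fintype ι] [DecidableEq ι]
    {n N : ℕ} (hN : 0 < N) (hn : n = 2 * N) (hι : Fintype.card ι = n) (a : ι → F)
    (ha : Function.Injective a) (w : F) (hw : w ≠ 0)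
    (h : ∀ i, IsSquare (w * ∏ j ∈ univ.erase i, (a i - a j))) :
    ∃ C : Submodule F (Fin n → F), IsMDSSelfDual C := by
  have σ : Fin n ≃ ι := (Fintype.equivFinOfCardEq hι).symm
  refine exists_isMDSSelfDual_of_isSquare hN hn (a ∘ σ) (ha.comp σ.injective) w hw fun i => ?_
  convert h (σ i) using 2
  refine Finset.prod_equiv σ (fun j => ?_) fun j _ => rfl
  simp

/-- The union of the subgroup of order `t` and one of its cosets, both consisting of squares,
has Lagrange weights that are squares up to sign and a common factor. -/
lemma exists_finset_isSquare_or_isSquare_neg {K : Type*} [Field K] [Fintype K] [DecidableEq K]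
    {t : ℕ} (ht : 0 < t) (hdvd : 2 * t ∣ Fintype.card K - 1)
    (hne : 2 * t ≠ Fintype.card K - 1) :
    ∃ (A : Finset K) (μ : K), #A = 2 * t ∧ μ ≠ 0 ∧ ∀ u ∈ A,
      IsSquare (μ * ∏ u' ∈ A.erase u, (u - u')) ∨
        IsSquare (-(μ * ∏ u' ∈ A.erase u, (u - u'))) := by
  obtain ⟨g, hg⟩ := IsCyclic.exists_generator (α := Kˣ)
  have hord : orderOf g = Fintype.card K - 1 := by
    rw [orderOf_eq_card_of_forall_mem_zpowers hg, Nat.card_eq_fintype_card, Fintype.card_units]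
  obtain ⟨d, hd⟩ := hdvd
  have hcard : 0 < Fintype.card K - 1 := by have := Fintype.one_lt_card (α := K); omega
  have hgprim : IsPrimitiveRoot (g : K) (t * (2 * d)) := by
    have := IsPrimitiveRoot.orderOf g
    rw [hord, hd, show 2 * t * d = t * (2 * d) by ring] at this
    exact IsPrimitiveRoot.coe_units_iff.2 this
  have hζ : IsPrimitiveRoot ((g : K) ^ (2 * d)) t := by
    refine hgprim.pow ?_ (by ring)
    rw [show t * (2 * d) = 2 * t * d by ring, ← hd]; exact hcard
  set ζ : K := (g : K) ^ (2 * d) with hζdef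
  set b : K := (g : K) ^ 2 with hbdef
  have hb0 : b ≠ 0 := pow_ne_zero _ g.ne_zero
  have hbt : b ^ t ≠ 1 := by
    intro h
    rw [hbdef, ← pow_mul, hgprim.pow_eq_one_iff_dvd, show t * (2 * d) = 2 * t * d by ring] at h
    exact hne (by rw [hd]; exact Nat.dvd_antisymm (dvd_mul_right _ _) h)
  have ht0 : (t : K) ≠ 0 := by
    intro h
    have : ((Fintype.card K - 1 : ℕ) : K) = 0 := by rw [hd]; push_cast; rw [h]; ring
    rw [Nat.cast_sub Fintype.card_pos, FiniteField.cast_card_eq_zero] at this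
    simp at this
  have hinj1 : Set.InjOn (fun i => ζ ^ i * 1) (range t : Set ℕ) := fun i hi j hj hij =>
    hζ.pow_inj (by simpa using hi) (by simpa using hj) (by simpa using hij)
  have hinj2 : Set.InjOn (fun i => ζ ^ i * b) (range t : Set ℕ) := fun i hi j hj hij =>
    hζ.pow_inj (by simpa using hi) (by simpa using hj) (mul_right_cancel₀ hb0 hij)
  have hpow : ∀ (c : K) (i : ℕ), (ζ ^ i * c) ^ t = c ^ t := fun c i => by
    rw [mul_pow, ← pow_mul, mul_comm i, pow_mul, hζ.pow_eq_one, one_pow, one_mul]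
  set A₁ := (range t).image fun i => ζ ^ i * 1 with hA₁
  set A₂ := (range t).image fun i => ζ ^ i * b with hA₂
  have hdisj : Disjoint A₁ A₂ := by
    rw [Finset.disjoint_left]
    intro x h1 h2
    obtain ⟨i, -, rfl⟩ := Finset.mem_image.1 h1
    obtain ⟨j, -, hj⟩ := Finset.mem_image.1 h2
    have := congrArg (· ^ t) hj
    simp only [hpow, one_pow] at this
    exact hbt this
  have hnodal : Lagrange.nodal (A₁ ∪ A₂) id = (X ^ t - C 1) * (X ^ t - C (b ^ t)) := by
    rw [Lagrange.nodal_eq, prod_union hdisj, hA₁, hA₂, prod_image hinj1, prod_image hinj2,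
      X_pow_sub_C_eq_prod hζ ht (one_pow t), X_pow_sub_C_eq_prod hζ ht (rfl : b ^ t = b ^ t)]
    rfl
  refine ⟨A₁ ∪ A₂, t * (1 - b ^ t), ?_, mul_ne_zero ht0 (sub_ne_zero.2 hbt.symm), fun u hu => ?_⟩
  · rw [card_union_of_disjoint hdisj, card_image_of_injOn hinj1, card_image_of_injOn hinj2,
      card_range]
    ring
  have hprod : ∏ u' ∈ (A₁ ∪ A₂).erase u, (u - u') =
      t * u ^ (t - 1) * (u ^ t - b ^ t) + (u ^ t - 1) * (t * u ^ (t - 1)) := by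
    have h1 := Lagrange.eval_nodal_derivative_eval_node_eq (v := id) hu
    rw [hnodal, Lagrange.eval_nodal] at h1
    simp only [id] at h1
    rw [← h1]
    simp [derivative_mul, derivative_X_pow, -map_pow]
  rw [hprod]
  have hsqζ : IsSquare ζ := ⟨(g : K) ^ d, by rw [hζdef]; ring⟩
  have hsqb : IsSquare b := ⟨g, by rw [hbdef]; ring⟩
  have hμ : IsSquare ((t * (1 - b ^ t)) ^ 2 : K) := IsSquare.sq _
  rcases Finset.mem_union.1 hu with hu | hu
  · left
    obtain ⟨i, -, rfl⟩ := Finset.mem_image.1 hu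
    rw [hpow]
    refine (congrArg IsSquare ?_).mpr (hμ.mul (((hsqζ.pow i).mul IsSquare.one).pow (t - 1)))
    ring
  · right
    obtain ⟨i, -, rfl⟩ := Finset.mem_image.1 hu
    rw [hpow]
    refine (congrArg IsSquare ?_).mpr (hμ.mul (((hsqζ.pow i).mul hsqb).pow (t - 1)))
    ring

lemma exists_submodule_finrank_eq_of_le {K V : Type*} [Field K] [AddCommGroup V] [Module K V]
    [FiniteDimensional K V] {e : ℕ} (he : e ≤ Module.finrank K V) :
    ∃ W : Submodule K V, Module.finrank K W = e := by
  have bs := Module.finBasis K V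
  refine ⟨Submodule.span K (Set.range (bs ∘ Fin.castLE he)), ?_⟩
  rw [finrank_span_eq_card (bs.linearIndependent.comp _ (Fin.castLE_injective he)),
    Fintype.card_fin]

/-- The differences between a point and the other points in a union of translates of a subspace
by multiples of `β`. -/
lemma prod_erase_smul_add_sub {K F : Type*} [Field K] [Field F] [Algebra K F] [Fintype K]
    [DecidableEq K] [DecidableEq F] (W : Submodule K F) [Fintype W] (β : F)
    (A : Finset K) (u : A) (x : W) :
    ∏ j ∈ univ.erase (u, x), ((u : K) • β + (x : F) - ((j.1 : K) • β + (j.2 : F))) =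
      (∏ y ∈ univ.erase (0 : W), (y : F)) * (∏ y : W, (β + y)) ^ (#A - 1) *
        algebraMap K F (∏ u' ∈ A.erase u, ((u : K) - u')) ^ Fintype.card W := by
  have hself : ∏ y ∈ univ.erase x, ((x : F) - y) = ∏ y ∈ univ.erase (0 : W), (y : F) := by
    refine Finset.prod_equiv (Equiv.subLeft x) (fun y => ?_) fun y _ => by simp
    simp [sub_eq_zero, eq_comm]
  have hother : ∀ u' : A, u' ≠ u → ∏ y : W, ((u : K) • β + (x : F) - ((u' : K) • β + (y : F))) =
      algebraMap K F ((u : K) - u') ^ Fintype.card W * ∏ y : W, (β + y) := by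
    intro u' hu'
    have hc : (u : K) - u' ≠ 0 := sub_ne_zero.2 fun h => hu' (Subtype.ext h.symm)
    rw [← card_univ, ← Finset.prod_const, ← Finset.prod_mul_distrib]
    symm
    refine Fintype.prod_equiv ((LinearEquiv.smulOfNeZero K W _ hc).toEquiv.trans
      (Equiv.subLeft x)) _ _ fun y => ?_
    simp [Algebra.smul_def]
    ring
  have hsplit : (univ.erase (u, x) : Finset (A × W)) =
      ({u} ×ˢ univ.erase x) ∪ (univ.erase u ×ˢ univ) := by
    ext ⟨a, y⟩
    simp only [mem_erase, mem_union, mem_product, mem_singleton, mem_univ, Prod.mk.injEq, ne_eq]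
    tauto
  have hdisj : Disjoint (({u} : Finset A) ×ˢ univ.erase x) (univ.erase u ×ˢ (univ : Finset W)) := by
    rw [Finset.disjoint_left]
    rintro ⟨a, y⟩ h1 h2
    exact (mem_erase.1 (mem_product.1 h2).1).1 (mem_singleton.1 (mem_product.1 h1).1)
  rw [hsplit, prod_union hdisj, prod_product, prod_product, prod_singleton,
    Finset.prod_congr rfl fun u' hu' => hother u' (Finset.mem_erase.1 hu').1,
    Finset.prod_mul_distrib, Finset.prod_const, card_erase_of_mem (mem_univ _), card_univ,
    Fintype.card_coe, Finset.prod_pow, ← map_prod]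
  simp only [add_sub_add_left_eq_sub]
  rw [hself]
  have hA : ∏ u' ∈ univ.erase u, ((u : K) - u') = ∏ u' ∈ A.erase u, ((u : K) - u') := by
    refine Finset.prod_bij (fun u' _ => (u' : K)) ?_ ?_ ?_ ?_
    · intro u' h
      exact mem_erase.2 ⟨fun h' => (mem_erase.1 h).1 (Subtype.ext h'), u'.2⟩
    · intro _ _ _ _ h; exact Subtype.ext h
    · intro c hc
      have := Finset.mem_erase.1 hc
      exact ⟨⟨c, this.2⟩, mem_erase.2 ⟨fun h => this.1 (congrArg Subtype.val h), mem_univ _⟩, rfl⟩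
    · intro _ _; rfl
  rw [hA]
  ring

lemma exists_isMDSSelfDual_of_algebra {K F : Type*} [Field K] [Field F] [Algebra K F] [Fintype K]
    [Fintype F] {t e : ℕ} (hF : Fintype.card F % 4 = 1)
    (ht : 0 < t) (hdvd : 2 * t ∣ Fintype.card K - 1) (hne : 2 * t ≠ Fintype.card K - 1)
    (he : e < Module.finrank K F) :
    ∃ C : Submodule F (Fin (2 * t * Fintype.card K ^ e) → F), IsMDSSelfDual C := by
  classical
  obtain ⟨A, μ, hA, hμ, hsq⟩ := exists_finset_isSquare_or_isSquare_neg ht hdvd hne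
  obtain ⟨W, hW⟩ := exists_submodule_finrank_eq_of_le (K := K) (V := F) he.le
  have hWcard : Fintype.card W = Fintype.card K ^ e := by
    rw [Module.card_eq_pow_finrank (K := K), hW]
  obtain ⟨β, hβ⟩ : ∃ β : F, β ∉ W := by
    by_contra! h
    have : W = ⊤ := eq_top_iff.2 fun x _ => h x
    rw [this, finrank_top] at hW
    omega
  have hL : ∏ y : W, (β + y) ≠ 0 := Finset.prod_ne_zero_iff.2 fun y _ h =>
    hβ (by rw [eq_neg_of_add_eq_zero_left h]; exact W.neg_mem y.2)
  have hc : ∏ y ∈ univ.erase (0 : W), (y : F) ≠ 0 := Finset.prod_ne_zero_iff.2 fun y hy h =>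
    (Finset.mem_erase.1 hy).1 (Subtype.ext h)
  have hneg : IsSquare (-1 : F) := FiniteField.isSquare_neg_one_iff.2 (by omega)
  have hsqF : ∀ u ∈ A, IsSquare (algebraMap K F (μ * ∏ u' ∈ A.erase u, (u - u'))) := by
    intro u hu
    rcases hsq u hu with h | h
    · exact h.map _
    · simpa using hneg.mul (h.map (algebraMap K F))
  refine exists_isMDSSelfDual_of_fintype (ι := A × W) (N := t * Fintype.card K ^ e)
    (Nat.mul_pos ht (pow_pos Fintype.card_pos _)) (by ring)
    (by rw [Fintype.card_prod, Fintype.card_coe, hA, hWcard])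
    (fun j => (j.1 : K) • β + (j.2 : F)) ?_
    ((∏ y ∈ univ.erase (0 : W), (y : F)) * (∏ y : W, (β + y)) *
      algebraMap K F μ ^ Fintype.card W)
    (mul_ne_zero (mul_ne_zero hc hL) (pow_ne_zero _ (by simpa using hμ))) ?_
  · rintro ⟨u, x⟩ ⟨u', x'⟩ h
    simp only at h
    have huu : u = u' := by
      by_contra hu
      have hu : (u : K) - u' ≠ 0 := sub_ne_zero.2 fun h => hu (Subtype.ext h)
      refine hβ ((W.smul_mem_iff hu).1 ?_)
      have : ((u : K) - u') • β = (x' : F) - x := by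
        rw [sub_smul]; linear_combination h
      rw [this]
      exact W.sub_mem x'.2 x.2
    subst huu
    exact Prod.ext rfl (Subtype.ext (add_left_cancel h))
  · rintro ⟨u, x⟩
    rw [prod_erase_smul_add_sub, hA]
    have h1 := (IsSquare.sq ((∏ y ∈ univ.erase (0 : W), (y : F)) *
      (∏ y : W, (β + y)) ^ t)).mul ((hsqF u u.2).pow (Fintype.card W))
    refine (congrArg IsSquare ?_).mpr h1
    obtain ⟨s, rfl⟩ : ∃ s, t = s + 1 := ⟨t - 1, by omega⟩
    rw [show 2 * (s + 1) - 1 = 2 * s + 1 by omega, map_mul]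
    ring

theorem stmt_1 (r m e t p k : ℕ) (hp : p.Prime) (hpodd : Odd p) (hr : r = p ^ k) (hk : 0 < k)
    (hm : 0 < m) (he : e ≤ m - 1) (hq4 : r ^ m % 4 = 1)
    (ht : 0 < t) (hdvd : 2 * t ∣ r - 1) (htne : t ≠ (r - 1) / 2)
    (F : Type*) [Field F] [Fintype F] (hF : Fintype.card F = r ^ m) :
    ∃ C : Submodule F (Fin (2 * t * r ^ e) → F), IsMDSSelfDual C := by
  have := Fact.mk hp
  have hkm : Fintype.card F = p ^ (k * m) := by rw [hF, hr, pow_mul]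
  have : CharP F p := charP_of_card_eq_prime_pow hkm
  let := ZMod.algebra F p
  have hrank : Module.finrank (ZMod p) F = k * m := by
    have h := Module.card_eq_pow_finrank (K := ZMod p) (V := F)
    rw [hkm, ZMod.card] at h
    exact (Nat.pow_right_injective hp.two_le h).symm
  obtain ⟨φ⟩ := FiniteField.nonempty_algHom_of_finrank_dvd (F := ZMod p) (K := GaloisField p k)
    (L := F) (by rw [GaloisField.finrank p hk.ne', hrank]; exact dvd_mul_right _ _)
  let := φ.toRingHom.toAlgebra
  let := Fintype.ofFinite (GaloisField p k)
  have hK : Fintype.card (GaloisField p k) = r := by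
    rw [← Nat.card_eq_fintype_card, GaloisField.card p k hk.ne', hr]
  have hm' : Module.finrank (GaloisField p k) F = m := by
    have h := Module.card_eq_pow_finrank (K := GaloisField p k) (V := F)
    rw [hF, hK] at h
    exact (Nat.pow_right_injective (hr ▸ hp.two_le.trans (Nat.le_self_pow hk.ne' p)) h).symm
  have := exists_isMDSSelfDual_of_algebra (K := GaloisField p k) (F := F) (t := t) (e := e)
    (by rw [hF]; exact hq4) ht
    (by rwa [hK]) (by rw [hK]; omega) (by omega)
  rwa [hK] at this
end

section
/- Let q = p^m where p is an odd prime and m is a positive integer, and suppose q ≡ 1 (mod 4). Let t be an even integer with 2 ≤ t ≤ p−1, and let e be an integer with 0 ≤ e ≤ m−1. If η(i(t+1−i)) = 1 for every integer i with 1 ≤ i ≤ t/2, then there exists an MDS self-dual code over F_q of length (t+1)·p^e + 1. -/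
open Finset

open Polynomial in
/-- The encoder of an extended generalized Reed–Solomon code with evaluation points `a`, column
multipliers `v`, and multiplier `w` at infinity, where messages have degree at most `d`. -/
noncomputable def extendedGRSEncoder {F : Type*} [Field F] {n : ℕ} (d : ℕ) (a v : Fin n → F)
    (w : F) : F[X] →ₗ[F] (Fin (n + 1) → F) where
  toFun f := Fin.cons (w * f.coeff d) fun i => v i * f.eval (a i)
  map_add' f g := by
    funext i
    refine Fin.cases ?_ (fun i => ?_) i <;> simp [mul_add]
  map_smul' r f := by
    funext i
    refine Fin.cases ?_ (fun i => ?_) i <;> simp [mul_left_comm]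

section Codes

variable {F : Type*} [Field F]

lemma hWeight_add_card_zeros {n : ℕ} (c : Fin n → F) [DecidablePred fun i => c i = 0] :
    hWeight c + #{i | c i = 0} = n := by
  classical
  rw [hWeight, Nat.card_eq_fintype_card, Fintype.card_subtype, add_comm]
  simpa using card_filter_add_card_filter_not (s := (univ : Finset (Fin n))) (fun i => c i = 0)

lemma finrank_add_finrank_euclideanDual {n : ℕ} (C : Submodule F (Fin n → F)) :
    Module.finrank F C + Module.finrank F (euclideanDual C) = n := by
  classical
  have hB : (Matrix.toBilin' (1 : Matrix (Fin n) (Fin n) F)).Nondegenerate :=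
    LinearMap.BilinForm.nondegenerate_toBilin'_iff_det_ne_zero.2 (by simp)
  have hC : euclideanDual C = (Matrix.toBilin' (1 : Matrix (Fin n) (Fin n) F)).orthogonal C := by
    ext x
    rw [LinearMap.BilinForm.mem_orthogonal_iff]
    refine forall₂_congr fun c _ => ?_
    rw [Matrix.toBilin'_apply', Matrix.one_mulVec, dotProduct_comm]
    rfl
  have hle := Submodule.finrank_le C
  rw [hC, LinearMap.BilinForm.finrank_orthogonal hB]
  simp only [Module.finrank_fin_fun] at hle ⊢
  lia

lemma eq_euclideanDual_of_le {n k : ℕ} {C : Submodule F (Fin n → F)} (hle : C ≤ euclideanDual C)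
    (hk : Module.finrank F C = k) (hn : n = 2 * k) : C = euclideanDual C := by
  refine Submodule.eq_of_le_of_finrank_eq hle ?_
  have := finrank_add_finrank_euclideanDual C
  lia

open Polynomial

lemma card_eval_eq_zero_le_natDegree {ι : Type*} [Fintype ι] {a : ι → F}
    (ha : Function.Injective a) {f : F[X]} (hf : f ≠ 0)
    [DecidablePred fun i => f.eval (a i) = 0] :
    #{i | f.eval (a i) = 0} ≤ f.natDegree := by
  classical
  rw [← card_image_of_injective _ ha]
  refine card_le_degree_of_subset_roots fun x hx => ?_
  obtain ⟨i, hi, rfl⟩ := mem_image.1 (mem_def.2 hx)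
  exact (mem_roots hf).2 (mem_filter.1 hi).2

variable {n d : ℕ} {a v : Fin n → F} {w : F}

lemma card_zeros_extendedGRSEncoder_le [DecidableEq F] (ha : Function.Injective a)
    (hv : ∀ i, v i ≠ 0) (hw : w ≠ 0) {f : F[X]} (hf : f ≠ 0) (hdeg : f.degree < (d + 1 : ℕ)) :
    #{i | extendedGRSEncoder d a v w f i = 0} ≤ d := by
  have hcard := card_eval_eq_zero_le_natDegree ha hf
  have hnat : f.natDegree ≤ d := Nat.lt_succ_iff.1 ((natDegree_lt_iff_degree_lt hf).2 hdeg)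
  rw [Fin.card_filter_univ_succ]
  simp only [extendedGRSEncoder, LinearMap.coe_mk, AddHom.coe_mk, Fin.cons_zero, Fin.cons_succ,
    mul_eq_zero, hv, hw, false_or]
  split_ifs with h0
  · have : f.natDegree ≠ d := by
      rintro rfl
      exact hf (leadingCoeff_eq_zero.1 h0)
    lia
  · lia

lemma sum_extendedGRSEncoder_mul (hn : n = 2 * d + 1) (ha : Function.Injective a)
    (hv : ∀ i, v i * v i * ∏ j ∈ univ.erase i, (a i - a j) = 1) (hw : w * w = -1) {f g : F[X]}
    (hf : f.degree < (d + 1 : ℕ)) (hg : g.degree < (d + 1 : ℕ)) :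
    ∑ i, extendedGRSEncoder d a v w f i * extendedGRSEncoder d a v w g i = 0 := by
  have hf' : f.natDegree ≤ d := natDegree_le_iff_degree_le.2 (Order.lt_succ_iff.1 hf)
  have hg' : g.natDegree ≤ d := natDegree_le_iff_degree_le.2 (Order.lt_succ_iff.1 hg)
  have hfg : (f * g).degree < #(univ : Finset (Fin n)) := by
    refine lt_of_le_of_lt (degree_le_of_natDegree_le (natDegree_mul_le_of_le hf' hg')) ?_
    rw [card_univ, Fintype.card_fin]
    exact_mod_cast (by lia)
  have key := Lagrange.coeff_eq_sum (ha.injOn) hfg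
  rw [card_univ, Fintype.card_fin, show n - 1 = d + d by lia,
    coeff_mul_add_eq_of_natDegree_le hf' hg'] at key
  rw [Fin.sum_univ_succ]
  simp only [extendedGRSEncoder, LinearMap.coe_mk, AddHom.coe_mk, Fin.cons_zero, Fin.cons_succ]
  have hsum : ∑ i, v i * f.eval (a i) * (v i * g.eval (a i)) = f.coeff d * g.coeff d := by
    rw [key]
    refine sum_congr rfl fun i _ => ?_
    rw [eq_div_iff (right_ne_zero_of_mul_eq_one (hv i)), eval_mul]
    linear_combination (f.eval (a i) * g.eval (a i)) * hv i
  rw [hsum]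
  linear_combination (f.coeff d * g.coeff d) * hw

/-- Evaluation points whose differences have square products give an MDS self-dual code. -/
theorem exists_isMDSSelfDual_of_isSquare_prod_sub (hn : n = 2 * d + 1)
    (ha : Function.Injective a) (hsq : ∀ i, IsSquare (∏ j ∈ univ.erase i, (a i - a j)))
    (h1 : IsSquare (-1 : F)) :
    ∃ C : Submodule F (Fin (n + 1) → F), IsMDSSelfDual C := by
  classical
  obtain ⟨w, hw⟩ := h1
  have hw0 : w ≠ 0 := by rintro rfl; simp at hw
  choose u hu using hsq
  have hprod : ∀ i, ∏ j ∈ univ.erase i, (a i - a j) ≠ 0 := fun i =>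
    prod_ne_zero_iff.2 fun j hj => sub_ne_zero.2 (ha.ne (ne_of_mem_erase hj).symm)
  have hu0 : ∀ i, u i ≠ 0 := fun i h => hprod i (by rw [hu, h, mul_zero])
  set E := extendedGRSEncoder d a (fun i => (u i)⁻¹) w with hE
  have hzeros : ∀ f ∈ degreeLT F (d + 1), f ≠ 0 → #{i | E f i = 0} ≤ d := fun f hf hf0 =>
    card_zeros_extendedGRSEncoder_le ha (fun i => inv_ne_zero (hu0 i)) hw0 hf0 (mem_degreeLT.1 hf)
  have hinj : ∀ f ∈ degreeLT F (d + 1), E f = 0 → f = 0 := by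
    intro f hf h
    by_contra hf0
    have := hzeros f hf hf0
    simp only [h, Pi.zero_apply, filter_true, card_univ, Fintype.card_fin] at this
    lia
  refine ⟨(degreeLT F (d + 1)).map E, eq_euclideanDual_of_le (k := d + 1) ?_ ?_ (by lia), ?_, ?_⟩
  · rintro _ ⟨f, hf, rfl⟩ _ ⟨g, hg, rfl⟩
    refine sum_extendedGRSEncoder_mul hn ha (fun i => ?_) hw.symm (mem_degreeLT.1 hf)
      (mem_degreeLT.1 hg)
    rw [hu]
    field_simp [hu0 i]
  · have hinj' : Function.Injective (E.domRestrict (degreeLT F (d + 1))) :=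
      (injective_iff_map_eq_zero _).2 fun f hf => Subtype.ext (hinj f f.2 hf)
    rw [← LinearMap.range_domRestrict, LinearMap.finrank_range_of_inj hinj',
      (degreeLTEquiv F (d + 1)).finrank_eq, Module.finrank_fin_fun]
  · rintro _ ⟨f, hf, rfl⟩ h0
    have := hzeros f hf (by rintro rfl; simp at h0)
    have := hWeight_add_card_zeros (E f)
    lia
  · let s : Finset (Fin n) := {i | i.val < d}
    have hs : #s = d := by
      simp only [s, Fin.card_filter_val_lt]
      lia
    let f : F[X] := ∏ i ∈ s, (X - C (a i))
    have hmonic : f.Monic := monic_prod_X_sub_C _ _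
    have hdeg : f ∈ degreeLT F (d + 1) := by
      rw [mem_degreeLT, degree_eq_natDegree hmonic.ne_zero, natDegree_finsetProd_X_sub_C_eq_card,
        hs]
      exact_mod_cast Nat.lt_succ_self d
    refine ⟨E f, ⟨f, hdeg, rfl⟩, fun h => hmonic.ne_zero (hinj f hdeg h), ?_⟩
    have hle := hzeros f hdeg hmonic.ne_zero
    have hge : #s ≤ #{i | E f i = 0} := by
      rw [← card_map (Fin.succEmb n)]
      refine card_le_card fun j hj => ?_
      obtain ⟨i, hi, rfl⟩ := mem_map.1 hj
      have : f.eval (a i) = 0 := by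
        rw [eval_prod]
        exact prod_eq_zero hi (by simp)
      simp [hE, extendedGRSEncoder, this]
    have := hWeight_add_card_zeros (E f)
    lia

end Codes

section SquareProducts

variable {F : Type*} [Field F]

lemma isSquare_prod_of_neg_mem [NeZero (2 : F)] (h1 : IsSquare (-1 : F)) (s : Finset F)
    (h0 : 0 ∉ s) (hneg : ∀ x ∈ s, -x ∈ s) : IsSquare (∏ x ∈ s, x) := by
  classical
  induction s using Finset.strongInduction with
  | H s ih =>
    obtain rfl | ⟨x, hx⟩ := s.eq_empty_or_nonempty
    · simp
    · have hx0 : x ≠ 0 := fun h => h0 (h ▸ hx)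
      have hne : -x ≠ x := fun h => hx0 (by
        have h2 : (2 : F) * x = 0 := by linear_combination -h
        exact (mul_eq_zero.1 h2).resolve_left two_ne_zero)
      have hx' : -x ∈ s.erase x := mem_erase.2 ⟨hne, hneg x hx⟩
      rw [← mul_prod_erase s _ hx, ← mul_prod_erase _ _ hx', ← mul_assoc]
      have hxx : x * -x = -1 * (x * x) := by ring
      rw [hxx]
      refine (h1.mul (IsSquare.mul_self x)).mul
        (ih _ ((erase_ssubset hx').trans (erase_ssubset hx)) (by simp [h0]) fun y hy => ?_)
      simp only [mem_erase, ne_eq, neg_inj] at hy ⊢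
      refine ⟨hy.2.1, fun h => hy.1 ?_, hneg y hy.2.2⟩
      rw [← h, neg_neg]

open Nat in
lemma prod_range_ite_sub_eq_factorial {t k : ℕ} (hk : k ≤ t) :
    ∏ j ∈ range (t + 1), (if k = j then 1 else (k - j : F)) =
      (-1) ^ (t - k) * ((k ! * (t - k)! : ℕ) : F) := by
  obtain ⟨r, rfl⟩ := Nat.exists_eq_add_of_le hk
  have hlow : ∏ j ∈ range k, (if k = j then 1 else (k - j : F)) = (k ! : ℕ) := by
    rw [← prod_range_add_one_eq_factorial, ← prod_range_reflect (fun j => j + 1),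
      Nat.cast_prod]
    refine prod_congr rfl fun j hj => ?_
    have hj := mem_range.1 hj
    rw [if_neg hj.ne', show k - 1 - j + 1 = k - j by lia, Nat.cast_sub hj.le]
  have hhigh : ∏ j ∈ range r, (if k = k + 1 + j then 1 else (k - (k + 1 + j : ℕ) : F)) =
      (-1) ^ r * (r ! : ℕ) := by
    rw [← prod_range_add_one_eq_factorial, Nat.cast_prod, ← card_range r, ← prod_const,
      card_range, ← prod_mul_distrib]
    refine prod_congr rfl fun j _ => ?_
    rw [if_neg (by lia)]
    push_cast
    ring
  rw [show k + r + 1 = k + 1 + r by lia, prod_range_add, prod_range_succ, hlow, hhigh,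
    Nat.add_sub_cancel_left]
  simp only [if_true]
  push_cast
  ring

open Nat in
lemma isSquare_factorial_of_even {t : ℕ} (ht : Even t)
    (h : ∀ i, 1 ≤ i → i ≤ t / 2 → IsSquare ((i * (t + 1 - i) : ℕ) : F)) :
    IsSquare ((t ! : ℕ) : F) := by
  obtain ⟨s, rfl⟩ := ht
  have hfac : (s + s)! = ∏ i ∈ range s, ((i + 1) * (s + s + 1 - (i + 1))) := by
    rw [← prod_range_add_one_eq_factorial, prod_range_add, prod_mul_distrib,
      ← prod_range_reflect (fun i => s + i + 1)]
    congr 1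
    refine prod_congr rfl fun i hi => ?_
    have := mem_range.1 hi
    lia
  rw [hfac, Nat.cast_prod]
  refine isSquare_prod _ fun i hi => ?_
  have := mem_range.1 hi
  exact h _ (by lia) (by lia)

open Nat in
lemma isSquare_factorial_mul_factorial {t : ℕ} (ht : Even t)
    (h : ∀ i, 1 ≤ i → i ≤ t / 2 → IsSquare ((i * (t + 1 - i) : ℕ) : F))
    (hne : ∀ i : ℕ, 1 ≤ i → i ≤ t → (i : F) ≠ 0) {k : ℕ} (hk : k ≤ t) :
    IsSquare ((k ! * (t - k)! : ℕ) : F) := by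
  induction k with
  | zero => simpa using isSquare_factorial_of_even ht h
  | succ k ih =>
    obtain ⟨r, rfl⟩ := Nat.exists_eq_add_of_le hk
    have hstep : IsSquare (((k + 1) * (r + 1) : ℕ) : F) := by
      rcases le_or_gt (k + 1) ((k + 1 + r) / 2) with hle | hle
      · convert! h (k + 1) (by lia) hle using 3
        lia
      · convert! h (r + 1) (by lia) (by have := Nat.even_iff.1 ht; lia) using 2
        rw [mul_comm]
        congr 1
        lia
    have hprev := ih (by lia)
    rw [show k + 1 + r - k = r + 1 by lia] at hprev
    have hr : ((r + 1 : ℕ) : F) ≠ 0 := hne _ (by lia) (by lia)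
    have heq : (((k + 1)! * r ! : ℕ) : F) =
        ((k ! * (r + 1)! : ℕ) : F) * (((k + 1) * (r + 1) : ℕ) : F) /
          (((r + 1 : ℕ) : F) * ((r + 1 : ℕ) : F)) := by
      rw [eq_div_iff (mul_ne_zero hr hr), Nat.factorial_succ, Nat.factorial_succ]
      push_cast
      ring
    rw [Nat.add_sub_cancel_left, heq]
    exact (hprev.mul hstep).div (IsSquare.mul_self _)

end SquareProducts

section Cosets

variable {F : Type*} [Field F] {V : AddSubgroup F}

lemma AddSubgroup.bijective_zsmul_of_cast_ne_zero [Finite V] {c : ℤ} (hc : (c : F) ≠ 0) :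
    Function.Bijective fun u : V => c • u := by
  refine Finite.injective_iff_bijective.1 fun u v huv => Subtype.ext ?_
  have := congrArg (Subtype.val : V → F) huv
  simpa [zsmul_eq_mul, hc] using this

lemma AddSubgroup.intCast_mul_notMem [Finite V] {c : ℤ} (hc : (c : F) ≠ 0) {b : F} (hb : b ∉ V) :
    (c : F) * b ∉ V := by
  intro h
  obtain ⟨u, hu⟩ := (bijective_zsmul_of_cast_ne_zero hc).2 ⟨_, h⟩
  have := congrArg (Subtype.val : V → F) hu
  simp only [coe_zsmul, zsmul_eq_mul, mul_eq_mul_left_iff, hc, or_false] at this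
  exact hb (this ▸ u.2)

lemma AddSubgroup.prod_intCast_mul_add_sub [Fintype V] {c : ℤ} (hc : (c : F) ≠ 0) (b : F)
    (v : V) :
    ∏ u : V, (c * b + (v - u)) = (c : F) ^ Fintype.card V * ∏ w : V, (b + w) := by
  have hbij : Function.Bijective fun w : V => v - c • w :=
    (Equiv.subLeft v).bijective.comp (bijective_zsmul_of_cast_ne_zero hc)
  rw [← hbij.prod_comp, ← card_univ, ← prod_const, ← prod_mul_distrib]
  refine prod_congr rfl fun w _ => ?_
  simp only [coe_sub, coe_zsmul, zsmul_eq_mul]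
  ring

lemma AddSubgroup.isSquare_prod_ite_sub [Fintype V] [DecidableEq V] [NeZero (2 : F)]
    (h1 : IsSquare (-1 : F)) (v : V) :
    IsSquare (∏ u : V, if v = u then 1 else (v - u : F)) := by
  classical
  have key := isSquare_prod_of_neg_mem h1 (((univ : Finset V).erase 0).image Subtype.val)
    (by simp) (by simp)
  rw [prod_image Subtype.val_injective.injOn] at key
  convert! key using 1
  rw [← (Equiv.subLeft v).prod_comp, ← mul_prod_erase univ _ (mem_univ 0)]
  simp only [Equiv.subLeft_apply, sub_zero, if_true, one_mul]
  refine prod_congr rfl fun w hw => ?_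
  rw [if_neg fun h => ne_of_mem_erase hw (sub_eq_self.1 h.symm)]
  simp

variable {p t : ℕ} [CharP F p] {b : F}

lemma intCast_sub_ne_zero_of_lt (htp : t < p) {j k : Fin (t + 1)} (h : k ≠ j) :
    (((k : ℤ) - (j : ℤ) : ℤ) : F) ≠ 0 := by
  push_cast
  refine sub_ne_zero.2 fun hkj => h (Fin.ext ?_)
  exact CharP.natCast_injOn_Iio F p (Set.mem_Iio.2 (by lia)) (Set.mem_Iio.2 (by lia)) hkj

/-- The points of the cosets `j * b + V` for `j ≤ t`. -/
def cosetPoint (V : AddSubgroup F) (t : ℕ) (b : F) (x : Fin (t + 1) × V) : F :=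
  (x.1 : ℕ) * b + x.2

lemma cosetPoint_injective [Finite V] (htp : t < p) (hb : b ∉ V) :
    Function.Injective (cosetPoint V t b) := by
  rintro ⟨k, v⟩ ⟨j, u⟩ h
  simp only [cosetPoint] at h
  by_cases hkj : k = j
  · subst hkj
    simpa using h
  · refine absurd ?_ (V.intCast_mul_notMem (intCast_sub_ne_zero_of_lt htp hkj) hb)
    convert! (u - v).2 using 1
    push_cast
    linear_combination h

lemma isSquare_prod_cosetPoint_sub [Fintype V] [DecidableEq V] [NeZero (2 : F)]
    (h1 : IsSquare (-1 : F)) (htp : t < p) (ht : Even t)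
    (h : ∀ i, 1 ≤ i → i ≤ t / 2 → IsSquare ((i * (t + 1 - i) : ℕ) : F))
    (x : Fin (t + 1) × V) :
    IsSquare (∏ y ∈ univ.erase x, (cosetPoint V t b x - cosetPoint V t b y)) := by
  obtain ⟨k, v⟩ := x
  have hite : ∏ y ∈ univ.erase (k, v), (cosetPoint V t b (k, v) - cosetPoint V t b y) =
      ∏ y, if (k, v) = y then 1 else cosetPoint V t b (k, v) - cosetPoint V t b y := by
    rw [← mul_prod_erase univ _ (mem_univ (k, v)), if_pos rfl, one_mul]
    exact prod_congr rfl fun y hy => (if_neg (ne_of_mem_erase hy).symm).symm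
  have hsame : ∏ u : V, (if (k, v) = (k, u) then 1 else
      cosetPoint V t b (k, v) - cosetPoint V t b (k, u)) =
      ∏ u : V, if v = u then 1 else (v - u : F) := by
    simp [cosetPoint]
  have hother : ∀ j ∈ univ.erase k, ∏ u : V, (if (k, v) = (j, u) then 1 else
      cosetPoint V t b (k, v) - cosetPoint V t b (j, u)) =
      (if k = j then 1 else (((k : ℕ) : F) - (j : ℕ))) ^ Fintype.card V * ∏ w : V, (b + w) := by
    intro j hj
    have hkj : k ≠ j := (ne_of_mem_erase hj).symm
    have := V.prod_intCast_mul_add_sub (intCast_sub_ne_zero_of_lt (F := F) htp hkj) b v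
    push_cast at this
    rw [if_neg hkj, ← this]
    refine prod_congr rfl fun u _ => ?_
    rw [if_neg (by simp [hkj])]
    simp only [cosetPoint]
    ring
  have hdiff : ∏ j ∈ univ.erase k, (if k = j then 1 else (((k : ℕ) : F) - (j : ℕ))) =
      (-1) ^ (t - k) * ((Nat.factorial k * Nat.factorial (t - k) : ℕ) : F) := by
    rw [← prod_range_ite_sub_eq_factorial (Nat.lt_succ_iff.1 k.2), prod_range,
      ← mul_prod_erase univ _ (mem_univ k), if_pos rfl, one_mul]
    simp only [Fin.ext_iff]
  rw [hite, Fintype.prod_prod_type, ← mul_prod_erase univ _ (mem_univ k), hsame,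
    prod_congr rfl hother, prod_mul_distrib, prod_pow, hdiff, prod_const, card_erase_of_mem
    (mem_univ k), card_univ, Fintype.card_fin, Nat.add_sub_cancel]
  refine (V.isSquare_prod_ite_sub h1 v).mul (IsSquare.mul (IsSquare.pow _ ?_) (ht.isSquare_pow _))
  refine (h1.pow _).mul (isSquare_factorial_mul_factorial ht h (fun i hi hit h0 => ?_) (by lia))
  exact Nat.not_dvd_of_pos_of_lt hi (by lia) ((CharP.cast_eq_zero_iff F p i).1 h0)

end Cosets

lemma isSquare_of_quadChar_eq_one {F : Type*} [Field F] {x : F} (h : quadChar F x = 1) :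
    IsSquare x := by
  unfold quadChar at h
  split_ifs at h <;> simp_all

lemma exists_addSubgroup_card_eq_pow {G : Type*} [AddGroup G] [Finite G] {p n : ℕ}
    (hp : p.Prime) (hdvd : p ^ n ∣ Nat.card G) : ∃ V : AddSubgroup G, Nat.card V = p ^ n := by
  have := Fact.mk hp
  obtain ⟨K, hK⟩ := Sylow.exists_subgroup_card_pow_prime (G := Multiplicative G) p hdvd
  exact ⟨Subgroup.toAddSubgroup' K, hK⟩

theorem stmt_3 (p m e t : ℕ) (hp : p.Prime) (hpodd : Odd p) (hm : 0 < m) (he : e ≤ m - 1)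
    (hq4 : p ^ m % 4 = 1) (ht : Even t) (ht2 : 2 ≤ t) (htp : t ≤ p - 1)
    (F : Type*) [Field F] [Fintype F] (hF : Fintype.card F = p ^ m)
    (hchi : ∀ i : ℕ, 1 ≤ i → i ≤ t / 2 →
      quadChar F ((i * (t + 1 - i) : ℕ) : F) = 1) :
    ∃ C : Submodule F (Fin ((t + 1) * p ^ e + 1) → F), IsMDSSelfDual C := by
  classical
  have := Fact.mk hp
  have : CharP F p := charP_of_card_eq_prime_pow hF
  have hp2 : p ≠ 2 := by rintro rfl; exact absurd hpodd (by decide)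
  have : NeZero (2 : F) := ⟨Ring.two_ne_zero (by rwa [ringChar.eq F p])⟩
  have htp' : t < p := by have := hp.pos; lia
  have h1 : IsSquare (-1 : F) := FiniteField.isSquare_neg_one_iff.2 (by lia)
  have hcard : Nat.card F = p ^ m := by rw [Nat.card_eq_fintype_card, hF]
  obtain ⟨V, hV⟩ := exists_addSubgroup_card_eq_pow (G := F) (n := e) hp
    (hcard ▸ pow_dvd_pow p (by lia))
  have hVtop : V ≠ ⊤ := by
    rintro rfl
    rw [AddSubgroup.card_top, hcard] at hV
    have := Nat.pow_right_injective hp.two_le hV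
    lia
  obtain ⟨b, hb⟩ : ∃ b, b ∉ V := by
    by_contra! hall
    exact hVtop (eq_top_iff.2 fun x _ => hall x)
  have hcardV : Fintype.card (Fin (t + 1) × V) = (t + 1) * p ^ e := by
    rw [Fintype.card_prod, Fintype.card_fin, ← hV, Nat.card_eq_fintype_card]
  let φ := (Fintype.equivFinOfCardEq hcardV).symm
  obtain ⟨d, hd⟩ : Odd ((t + 1) * p ^ e) := ht.add_one.mul hpodd.pow
  refine exists_isMDSSelfDual_of_isSquare_prod_sub hd (a := cosetPoint V t b ∘ φ)
    ((cosetPoint_injective htp' hb).comp φ.injective) (fun i => ?_) h1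
  convert! isSquare_prod_cosetPoint_sub (b := b) h1 htp' ht
    (fun i hi hit => isSquare_of_quadChar_eq_one (hchi i hi hit)) (φ i) using 1
  exact prod_equiv φ (by simp) (fun _ _ => rfl)
end

section
/- Let q = r^{sm} where r is an odd prime power, s ≥ 1 is an integer and m is an odd positive integer, and suppose q ≡ 1 (mod 4). Let t be an even integer with t dividing r−1 and 1 < t < r−1, and let e be an integer with 0 ≤ e ≤ s−1. Then there exists an MDS self-dual code over F_q of length t·r^e·(1 + r^s + r^{2s} + ⋯ + r^{s(m−1)}). -/
open Finset

open Polynomial in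
/-- The generalized Reed-Solomon code of dimension `k` with nodes `x` and multipliers `v`. -/
noncomputable def grsCode {F : Type*} [Field F] {n : ℕ} (x v : Fin n → F) (k : ℕ) :
    Submodule F (Fin n → F) :=
  (degreeLT F k).map (LinearMap.pi fun i => v i • leval (x i))

section GRS

open Polynomial

variable {F : Type*} [Field F] {n : ℕ} {x v : Fin n → F}

theorem mem_grsCode {k : ℕ} {c : Fin n → F} :
    c ∈ grsCode x v k ↔ ∃ P : F[X], P.degree < k ∧ ∀ i, c i = v i * P.eval (x i) := by
  simp only [grsCode, Submodule.mem_map, mem_degreeLT]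
  refine exists_congr fun P => and_congr_right fun _ => ?_
  rw [funext_iff]
  simp [eq_comm]

theorem sum_sq_mul_eval (hx : Function.Injective x) {lam : F}
    (hv : ∀ i, lam * v i ^ 2 * ∏ j ∈ univ.erase i, (x i - x j) = 1)
    {P : F[X]} (hP : P.degree < n) :
    lam * ∑ i, v i ^ 2 * P.eval (x i) = P.coeff (n - 1) := by
  have h := Lagrange.coeff_eq_sum (s := univ) (v := x) hx.injOn (P := P) (by simpa using hP)
  rw [card_univ, Fintype.card_fin] at h
  rw [h, mul_sum]
  refine sum_congr rfl fun i _ => ?_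
  have h0 : ∏ j ∈ univ.erase i, (x i - x j) ≠ 0 := right_ne_zero_of_mul_eq_one (hv i)
  rw [eq_div_iff h0]
  linear_combination P.eval (x i) * hv i

theorem hWeight_eq_sub {c : Fin n → F} : hWeight c = n - Nat.card {i // c i = 0} := by
  classical
  simp [hWeight, Nat.card_eq_fintype_card]

theorem card_eval_eq_zero_le (hx : Function.Injective x) {P : F[X]} (hP : P ≠ 0) :
    Nat.card {i // P.eval (x i) = 0} ≤ P.natDegree := by
  classical
  rw [Nat.card_eq_fintype_card, Fintype.card_subtype, ← card_image_of_injective _ hx]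
  refine (card_le_card ?_).trans (P.roots.toFinset_card_le.trans P.card_roots')
  intro y hy
  obtain ⟨i, hi, rfl⟩ := mem_image.1 hy
  simpa [hP] using hi

theorem isMDSSelfDual_grsCode (hn : Even n) (hn0 : 0 < n) (hx : Function.Injective x) {lam : F}
    (hv : ∀ i, lam * v i ^ 2 * ∏ j ∈ univ.erase i, (x i - x j) = 1) :
    IsMDSSelfDual (grsCode x v (n / 2)) := by
  have hv0 (i) : v i ≠ 0 := by
    rintro h
    simpa [h] using hv i
  have hlam : lam ≠ 0 := by
    rintro rfl
    simpa using hv ⟨0, hn0⟩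
  have hzero (P : F[X]) : {i // v i * P.eval (x i) = 0} = {i // P.eval (x i) = 0} := by
    simp [hv0]
  obtain ⟨k, rfl⟩ := hn
  have hk : (k + k) / 2 = k := by omega
  rw [hk]
  refine ⟨le_antisymm ?_ ?_, ?_, ?_⟩
  · intro c hc d hd
    obtain ⟨P, hP, hcP⟩ := mem_grsCode.1 hc
    obtain ⟨R, hR, hdR⟩ := mem_grsCode.1 hd
    rcases eq_or_ne P 0 with rfl | hP0
    · simp [hcP]
    rcases eq_or_ne R 0 with rfl | hR0
    · simp [hdR]
    have hP' := (natDegree_lt_iff_degree_lt hP0).2 hP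
    have hR' := (natDegree_lt_iff_degree_lt hR0).2 hR
    have hdeg : (P * R).natDegree < k + k - 1 := by
      rw [natDegree_mul hP0 hR0]
      omega
    have h := sum_sq_mul_eval hx hv (P := P * R)
      ((natDegree_lt_iff_degree_lt (mul_ne_zero hP0 hR0)).1 (by omega))
    rw [coeff_eq_zero_of_natDegree_lt hdeg] at h
    rw [← (mul_eq_zero.1 h).resolve_left hlam]
    refine sum_congr rfl fun i _ => ?_
    rw [hcP, hdR, eval_mul]
    ring
  · intro c hc
    set R : F[X] := Lagrange.interpolate univ x (fun i => c i / v i) with hRdef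
    have hRx (i) : R.eval (x i) = c i / v i :=
      Lagrange.eval_interpolate_at_node _ hx.injOn (mem_univ i)
    have hRdeg : R.degree < (k + k : ℕ) := by
      have h := Lagrange.degree_interpolate_lt (fun i => c i / v i) (s := univ) hx.injOn
      rwa [card_univ, Fintype.card_fin] at h
    refine mem_grsCode.2 ⟨R, ?_, fun i => by rw [hRx, mul_div_cancel₀ _ (hv0 i)]⟩
    rcases eq_or_ne R 0 with h0 | hR0
    · rw [h0, degree_zero]
      exact WithBot.bot_lt_coe _
    by_contra hlt
    rw [← natDegree_lt_iff_degree_lt hR0] at hlt hRdeg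
    have h := hc (fun i => v i * (X ^ (k + k - 1 - R.natDegree) : F[X]).eval (x i))
      (mem_grsCode.2 ⟨_, (degree_X_pow_le _).trans_lt (by exact_mod_cast (by omega)),
        fun _ => rfl⟩)
    have hs := sum_sq_mul_eval hx hv (P := X ^ (k + k - 1 - R.natDegree) * R)
      ((natDegree_lt_iff_degree_lt (mul_ne_zero (pow_ne_zero _ X_ne_zero) hR0)).1 (by
        rw [natDegree_mul (pow_ne_zero _ X_ne_zero) hR0, natDegree_X_pow]
        omega))
    have hsum : ∑ i, v i ^ 2 * (X ^ (k + k - 1 - R.natDegree) * R).eval (x i) = 0 := by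
      rw [← h]
      refine sum_congr rfl fun i _ => ?_
      rw [eval_mul, hRx]
      field_simp [hv0 i]
    have hlead : (X ^ (k + k - 1 - R.natDegree) * R).coeff (k + k - 1) = R.leadingCoeff := by
      rw [coeff_X_pow_mul', if_pos (by omega), leadingCoeff]
      congr 1
      omega
    rw [hsum, mul_zero, hlead] at hs
    exact hR0 (leadingCoeff_eq_zero.1 hs.symm)
  · intro c hc hc0
    obtain ⟨P, hP, hcP⟩ := mem_grsCode.1 hc
    have hP0 : P ≠ 0 := by
      rintro rfl
      exact hc0 (funext fun i => by simp [hcP])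
    have h := card_eval_eq_zero_le hx hP0
    have hP' := (natDegree_lt_iff_degree_lt hP0).2 hP
    rw [hWeight_eq_sub]
    simp only [hcP, hzero]
    omega
  · obtain ⟨T, hT⟩ := exists_subset_card_eq (s := (univ : Finset (Fin (k + k)))) (n := k - 1)
      (by simp; omega)
    have hroot (i) : (Lagrange.nodal T x).eval (x i) = 0 ↔ i ∈ T := by
      simp [Lagrange.eval_nodal, prod_eq_zero_iff, sub_eq_zero, hx.eq_iff]
    have hw : hWeight (fun i => v i * (Lagrange.nodal T x).eval (x i)) = k + 1 := by
      rw [hWeight_eq_sub]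
      simp only [hzero, hroot]
      rw [Nat.card_eq_fintype_card, Fintype.card_coe, hT.2]
      omega
    refine ⟨_, mem_grsCode.2 ⟨Lagrange.nodal T x, ?_, fun _ => rfl⟩, ?_, hk.symm ▸ hw⟩
    · rw [Lagrange.degree_nodal, hT.2]
      exact_mod_cast (by omega)
    · intro h0
      rw [h0] at hw
      simp [hWeight] at hw

theorem exists_isMDSSelfDual_of_isSquare_s5 [DecidableEq F] (hn : Even n) (hn0 : 0 < n)
    {S : Finset F} (hS : #S = n) {lam : F} (hlam : lam ≠ 0)
    (h : ∀ a ∈ S, IsSquare (lam * ∏ b ∈ S.erase a, (a - b))) :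
    ∃ C : Submodule F (Fin n → F), IsMDSSelfDual C := by
  let e := (S.equivFinOfCardEq hS).symm
  choose w hw using fun i => h (e i) (e i).2
  have hx : Function.Injective fun i => (e i : F) := Subtype.val_injective.comp e.injective
  refine ⟨_, isMDSSelfDual_grsCode (x := fun i => (e i : F)) (v := fun i => (w i)⁻¹)
    (lam := lam) hn hn0 hx fun i => ?_⟩
  have himg : (univ.erase i).image (fun j => (e j : F)) = S.erase (e i) := by
    rw [image_erase hx]
    congr 1
    ext a
    simp only [mem_image, mem_univ, true_and]
    exact ⟨fun ⟨j, hj⟩ => hj ▸ (e j).2, fun ha => ⟨e.symm ⟨a, ha⟩, by simp⟩⟩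
  have hprod : ∏ j ∈ univ.erase i, ((e i : F) - e j) = ∏ b ∈ S.erase (e i), ((e i : F) - b) := by
    rw [← himg, prod_image hx.injOn]
  have hne : ∏ b ∈ S.erase (e i : F), ((e i : F) - b) ≠ 0 :=
    prod_ne_zero_iff.2 fun b hb => sub_ne_zero.2 (ne_of_mem_erase hb).symm
  have hw0 : w i ≠ 0 := by
    intro h0
    have := hw i
    rw [h0, mul_zero] at this
    exact mul_ne_zero hlam hne this
  rw [hprod, inv_pow, mul_right_comm, hw i]
  field_simp

end GRS

open Polynomial in
/-- The elements of a finite field whose `M`-th power lies in `A` form a set of `#A * M` elements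
when `A` consists of `M`-th powers; its vanishing polynomial is that of `A` evaluated at `X ^ M`. -/
theorem exists_pow_preimage {K : Type*} [Field K] [Fintype K] [DecidableEq K] {M N : ℕ}
    (hMN : M * N + 1 = Fintype.card K) {A : Finset K} (hA : ∀ a ∈ A, a ^ N = 1) :
    ∃ S : Finset K, #S = #A * M ∧ ∀ x ∈ S, x ^ M ∈ A ∧
      ∏ y ∈ S.erase x, (x - y) =
        (∏ a ∈ A.erase (x ^ M), (x ^ M - a)) * (M * x ^ (M - 1)) := by
  have hMN0 : M * N ≠ 0 := by
    have := Fintype.one_lt_card (α := K)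
    omega
  have hM : M ≠ 0 := left_ne_zero_of_mul hMN0
  have hN : N ≠ 0 := right_ne_zero_of_mul hMN0
  have hmon : (Lagrange.nodal A id).Monic := Lagrange.nodal_monic
  have hdvd : Lagrange.nodal A id ∣ (X ^ N - 1 : K[X]) := by
    have hne : (X ^ N - 1 : K[X]) ≠ 0 := X_pow_sub_C_ne_zero (Nat.pos_of_ne_zero hN) 1
    have h := (Multiset.prod_X_sub_C_dvd_iff_le_roots hne A.val).2
      ((Multiset.le_iff_subset A.nodup).2 fun a ha => by
        rw [mem_roots hne]
        simp [hA a ha])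
    simpa [Lagrange.nodal] using h
  set f : K[X] := (Lagrange.nodal A id).comp (X ^ M) with hf
  have hfdvd : f ∣ X ^ (M * N) - 1 := by
    obtain ⟨g, hg⟩ := hdvd
    refine ⟨g.comp (X ^ M), ?_⟩
    rw [hf, ← mul_comp, ← hg]
    simp [pow_mul]
  have hcard : (X ^ Fintype.card K - X : K[X]) = X * (X ^ (M * N) - 1) := by
    rw [← hMN]
    ring
  have hfdvd' : f ∣ X ^ Fintype.card K - X := hcard ▸ hfdvd.mul_left X
  have hbig0 : (X ^ Fintype.card K - X : K[X]) ≠ 0 :=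
    FiniteField.X_pow_card_sub_X_ne_zero K Fintype.one_lt_card
  have hfmon : f.Monic := hmon.comp (monic_X_pow M) (by simpa using hM)
  have hfsplit : f.Splits := by
    refine Splits.of_dvd (splits_iff_card_roots.2 ?_) hbig0 hfdvd'
    rw [FiniteField.roots_X_pow_card_sub_X,
      FiniteField.X_pow_card_sub_X_natDegree_eq K Fintype.one_lt_card]
    rfl
  have hnodup : f.roots.Nodup := by
    refine Multiset.nodup_of_le (roots.le_of_dvd hbig0 hfdvd') ?_
    rw [FiniteField.roots_X_pow_card_sub_X]
    exact univ.nodup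
  have hfS : Lagrange.nodal f.roots.toFinset id = f := by
    conv_rhs => rw [hfsplit.eq_prod_roots_of_monic hfmon]
    rw [Lagrange.nodal_eq, Finset.prod, Multiset.toFinset_val, Multiset.dedup_eq_self.2 hnodup]
    rfl
  refine ⟨f.roots.toFinset, ?_, fun x hx => ?_⟩
  · rw [← Lagrange.natDegree_nodal (R := K) (v := id), hfS, hf, natDegree_comp,
      Lagrange.natDegree_nodal, natDegree_X_pow]
  · have hxA : x ^ M ∈ A := by
      have : f.eval x = 0 := (mem_roots'.1 (Multiset.mem_toFinset.1 hx)).2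
      rw [hf, eval_comp, Lagrange.eval_nodal, prod_eq_zero_iff] at this
      obtain ⟨a, ha, h⟩ := this
      simp only [eval_pow, eval_X, id, sub_eq_zero] at h
      exact h ▸ ha
    refine ⟨hxA, ?_⟩
    have h1 := Lagrange.eval_nodal_derivative_eval_node_eq (v := (id : K → K)) hx
    have h2 := Lagrange.eval_nodal_derivative_eval_node_eq (v := (id : K → K)) hxA
    rw [hfS, hf, derivative_comp] at h1
    simp only [Lagrange.eval_nodal, id, eval_mul, eval_comp, derivative_X_pow, eval_pow, eval_X,
      eval_C] at h1 h2
    rw [← h1, h2]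
    simp [mul_comm]

/-- Over a finite field of odd order, every even proper divisor `t` of the order of the unit group
is the size of a set of units whose differences multiply to a prescribed square class up to
sign. -/
theorem exists_finset_isSquare_prod_sub {K : Type*} [Field K] [Fintype K] [DecidableEq K]
    {t : ℕ} (hK : Odd (Fintype.card K)) (ht : Even t) (hdvd : t ∣ Fintype.card K - 1)
    (htlt : t < Fintype.card K - 1) :
    ∃ B : Finset K, #B = t ∧ 0 ∉ B ∧ ∃ lam : K, lam ≠ 0 ∧ ∀ b ∈ B,
      IsSquare (lam * ∏ c ∈ B.erase b, (b - c)) ∨ IsSquare (-(lam * ∏ c ∈ B.erase b, (b - c))) := by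
  obtain ⟨u, rfl⟩ := ht
  obtain ⟨w, hw⟩ := hdvd
  have hcard := Fintype.one_lt_card (α := K)
  have hu : 0 < u := by
    rcases Nat.eq_zero_or_pos u with rfl | h
    · simp at hw
      omega
    · exact h
  have huw : u * (2 * w) + 1 = Fintype.card K := by
    have : (u + u) * w = u * (2 * w) := by ring
    omega
  have hchar : ringChar K ≠ 2 := by
    intro h
    have := FiniteField.even_card_iff_char_two.1 h
    rw [Nat.odd_iff] at hK
    omega
  have hhalf : Fintype.card K / 2 = u * w := by
    have : u * (2 * w) = 2 * (u * w) := by ring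
    omega
  have hsq {y : K} (hy : y ^ u = 1) : IsSquare y := by
    have hy0 : y ≠ 0 := by
      rintro rfl
      simp [hu.ne'] at hy
    rw [FiniteField.isSquare_iff hchar hy0, hhalf, pow_mul, hy, one_pow]
  obtain ⟨d, hd⟩ := IsCyclic.exists_generator (α := Kˣ)
  have hord : orderOf d = Fintype.card K - 1 := by
    rw [orderOf_eq_card_of_forall_mem_zpowers hd, Nat.card_eq_fintype_card, Fintype.card_units]
  have hd1 : d ^ (u + u) ≠ 1 := pow_ne_one_of_lt_orderOf (by omega) (by omega)
  have hgam : ((d : K) ^ 2) ^ u ≠ 1 := by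
    intro h
    refine hd1 (Units.ext ?_)
    rw [← two_mul, pow_mul]
    push_cast
    exact h
  set g : K := ((d : K) ^ 2) ^ u with hg
  have hg0 : g ≠ 0 := by simp [hg]
  have hgN : g ^ (2 * w) = 1 := by
    rw [hg, ← pow_mul, ← pow_mul, show 2 * (u * (2 * w)) = (Fintype.card K - 1) * 2 by
      rw [← huw, Nat.add_sub_cancel]; ring, pow_mul, FiniteField.pow_card_sub_one_eq_one _ d.ne_zero,
      one_pow]
  obtain ⟨B, hB, hBprod⟩ := exists_pow_preimage huw (A := {1, g}) (by simp [hgN])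
  have huK : (u : K) ≠ 0 := by
    intro h
    have h1 : ((u * (2 * w) + 1 : ℕ) : K) = 0 := by rw [huw, Nat.cast_card_eq_zero]
    push_cast at h1
    simp [h] at h1
  have hpowsq {b : K} (hb : b ^ u = 1 ∨ b ^ u = g) : IsSquare b := by
    rcases hb with h | h
    · exact hsq h
    · have : b = d ^ 2 * (b / d ^ 2) := by field_simp
      rw [this]
      refine (IsSquare.sq (d : K)).mul (hsq ?_)
      rw [div_pow, h, hg, div_self hg0]
  refine ⟨B, ?_, fun h0 => ?_, (1 - g) * u, mul_ne_zero (sub_ne_zero.2 hgam.symm) huK,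
    fun b hb => ?_⟩
  · rw [hB, card_pair hgam.symm]
    omega
  · have := (hBprod 0 h0).1
    simp [hu.ne', hg0.symm] at this
  · obtain ⟨hbA, hprod⟩ := hBprod b hb
    simp only [mem_insert, mem_singleton] at hbA
    have hbs : IsSquare (b ^ (u - 1)) := (hpowsq hbA).pow _
    have hss : IsSquare (((1 - g) * u) ^ 2 * b ^ (u - 1)) := (IsSquare.sq _).mul hbs
    rw [hprod]
    rcases hbA with h | h
    · left
      rw [h, show ({1, g} : Finset K).erase 1 = {g} by
        rw [erase_insert (by simpa using hgam.symm)], prod_singleton]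
      convert hss using 1
      ring
    · right
      rw [h, show ({1, g} : Finset K).erase g = {1} by
        rw [pair_comm, erase_insert (by simpa using hgam)], prod_singleton]
      convert hss using 1
      ring

theorem Submodule.exists_finrank_eq_notMem {K E : Type*} [Field K] [AddCommGroup E] [Module K E]
    [FiniteDimensional K E] {w : E} (hw : w ≠ 0) {e : ℕ} (he : e < Module.finrank K E) :
    ∃ V : Submodule K E, Module.finrank K V = e ∧ w ∉ V := by
  obtain ⟨f, hf⟩ : ∃ f : Module.Dual K E, f w ≠ 0 := by
    by_contra! h
    exact hw ((Module.forall_dual_apply_eq_zero_iff K w).1 h)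
  have hker : e ≤ Module.finrank K (LinearMap.ker f) := by
    have h1 := f.finrank_range_add_finrank_ker
    have h2 := (LinearMap.range f).finrank_le
    rw [Module.finrank_self] at h2
    omega
  obtain ⟨v, hv⟩ := exists_linearIndependent_of_le_finrank hker
  refine ⟨(Submodule.span K (Set.range v)).map (LinearMap.ker f).subtype, ?_, ?_⟩
  · rw [Submodule.finrank_map_subtype_eq, finrank_span_eq_card hv, Fintype.card_fin]
  · rintro ⟨y, -, rfl⟩
    exact hf y.2

/-- The union of the translates of `V` by elements of `B` has, up to a constant factor, the same
products of differences as `B`, raised to the power `#V`. -/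
theorem exists_prod_sub_eq {K E : Type*} [Field K] [Field E] [Fintype E] [DecidableEq K]
    [DecidableEq E] [Algebra K E] {V : Submodule K E} (hV : (1 : E) ∉ V) (B : Finset K) :
    ∃ κ : E, κ ≠ 0 ∧ ∃ A : Finset E, #A = #B * Nat.card V ∧ ∀ a ∈ A, ∃ b ∈ B,
      a - algebraMap K E b ∈ V ∧
      ∏ c ∈ A.erase a, (a - c) =
        κ * algebraMap K E (∏ c ∈ B.erase b, (b - c)) ^ Nat.card V := by
  classical
  have hmem {c : K} (hc : algebraMap K E c ∈ V) : c = 0 := by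
    by_contra h0
    refine hV ?_
    have := V.smul_mem c⁻¹ hc
    rwa [Algebra.smul_def, ← map_mul, inv_mul_cancel₀ h0, map_one] at this
  set W : Finset E := univ.filter (· ∈ V) with hW
  have hWV (x : E) : x ∈ W ↔ x ∈ V := by simp [hW]
  have hcard : #W = Nat.card V := by
    rw [Nat.card_eq_fintype_card, Fintype.card_subtype]
  let j : K × E → E := fun z => algebraMap K E z.1 + z.2
  have hj : Set.InjOn j (B ×ˢ W : Finset (K × E)) := by
    rintro ⟨b, v⟩ h ⟨b', v'⟩ h' heq
    simp only [coe_product, Set.mem_prod, mem_coe, hWV] at h h'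
    have heq' : algebraMap K E b + v = algebraMap K E b' + v' := heq
    have hb : b - b' = 0 := hmem (by
      rw [map_sub, show algebraMap K E b - algebraMap K E b' = v' - v by
        linear_combination heq']
      exact V.sub_mem h'.2 h.2)
    obtain rfl := sub_eq_zero.1 hb
    simpa using heq'
  refine ⟨(∏ u ∈ W.erase 0, u) * (∏ u ∈ W, (1 + u)) ^ (#B - 1), mul_ne_zero
    (prod_ne_zero_iff.2 fun u hu => ne_of_mem_erase hu) (pow_ne_zero _
    (prod_ne_zero_iff.2 fun u hu h0 => hV ?_)), (B ×ˢ W).image j, ?_, ?_⟩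
  · rw [eq_neg_of_add_eq_zero_left h0]
    exact V.neg_mem ((hWV u).1 hu)
  · rw [card_image_of_injOn hj, card_product, hcard]
  · intro a ha
    obtain ⟨⟨b, v⟩, hbv, rfl⟩ := mem_image.1 ha
    obtain ⟨hb, hv⟩ := mem_product.1 hbv
    have hv' : v ∈ V := (hWV v).1 hv
    refine ⟨b, hb, by simpa [j] using hv', ?_⟩
    have herase : ((B ×ˢ W).image j).erase (j (b, v)) = ((B ×ˢ W).erase (b, v)).image j := by
      ext y
      simp only [mem_erase, mem_image]
      constructor
      · rintro ⟨hy, z, hz, rfl⟩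
        exact ⟨z, ⟨fun h => hy (h ▸ rfl), hz⟩, rfl⟩
      · rintro ⟨z, ⟨hne, hz⟩, rfl⟩
        exact ⟨fun h => hne (hj hz hbv h), z, hz, rfl⟩
    have hunion : (B ×ˢ W).erase (b, v) = ({b} ×ˢ W.erase v) ∪ (B.erase b ×ˢ W) := by
      ext ⟨c, u⟩
      simp only [mem_erase, mem_product, mem_union, mem_singleton, ne_eq, Prod.mk.injEq]
      by_cases h : c = b
      · subst h
        simp [hb]
      · simp [h]
    have hdisj : Disjoint ({b} ×ˢ W.erase v) (B.erase b ×ˢ W) :=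
      disjoint_product.2 (Or.inl (by simp))
    have hself : ∏ u ∈ W.erase v, (j (b, v) - j (b, u)) = ∏ u ∈ W.erase 0, u := by
      refine prod_nbij' (fun u => v - u) (fun u => v - u) ?_ ?_ ?_ ?_ ?_
      · intro u hu
        simp only [mem_erase, hWV] at hu ⊢
        exact ⟨sub_ne_zero.2 (Ne.symm hu.1), V.sub_mem hv' hu.2⟩
      · intro u hu
        simp only [mem_erase, hWV] at hu ⊢
        exact ⟨by simpa using hu.1, V.sub_mem hv' hu.2⟩
      · simp
      · simp
      · intro u _
        simp [j]
    have hother : ∀ c ∈ B.erase b, ∏ u ∈ W, (j (b, v) - j (c, u)) =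
        algebraMap K E (b - c) ^ Nat.card V * ∏ u ∈ W, (1 + u) := by
      intro c hc
      have hbc : b - c ≠ 0 := sub_ne_zero.2 (ne_of_mem_erase hc).symm
      rw [← hcard, ← prod_const, ← prod_mul_distrib]
      refine prod_nbij' (fun u => (b - c)⁻¹ • (v - u)) (fun u => v - (b - c) • u) ?_ ?_ ?_ ?_ ?_
      · intro u hu
        rw [hWV] at hu ⊢
        exact V.smul_mem _ (V.sub_mem hv' hu)
      · intro u hu
        rw [hWV] at hu ⊢
        exact V.sub_mem hv' (V.smul_mem _ hu)
      · intro u _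
        simp [smul_inv_smul₀ hbc]
      · intro u _
        simp [inv_smul_smul₀ hbc]
      · intro u _
        rw [mul_add, ← Algebra.smul_def (b - c) (_ • _), smul_inv_smul₀ hbc]
        simp only [j, map_sub]
        ring
    rw [herase, prod_image (hj.mono (by simp)), hunion, prod_union hdisj,
      prod_product, prod_singleton, prod_product, hself, prod_congr rfl hother, prod_mul_distrib,
      prod_const, card_erase_of_mem hb, map_prod, prod_pow]
    ring

theorem exists_isMDSSelfDual_of_tower {K E F : Type*} [Field K] [Fintype K] [Field E] [Fintype E]
    [Field F] [Fintype F] [Algebra K E] [Algebra E F] {r s m e t : ℕ} (hr : Odd r) (hm : Odd m)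
    (hK : Fintype.card K = r) (hE : Fintype.card E = r ^ s) (hF : Fintype.card F = r ^ (s * m))
    (hq4 : r ^ (s * m) % 4 = 1) (ht : Even t) (ht0 : 0 < t) (hdvd : t ∣ r - 1) (htlt : t < r - 1)
    (he : e < s) :
    ∃ C : Submodule F (Fin (t * r ^ e * ∑ i ∈ Finset.range m, r ^ (s * i)) → F),
      IsMDSSelfDual C := by
  classical
  have hr1 : 1 < r := by omega
  have hfin : Module.finrank K E = s := by
    have h := Module.card_eq_pow_finrank (K := K) (V := E)
    rw [hE, hK] at h
    exact (Nat.pow_right_injective hr1 h).symm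
  obtain ⟨B, hB, hB0, lam, hlam, hBsq⟩ := exists_finset_isSquare_prod_sub (K := K) (t := t)
    (hK ▸ hr) ht (hK ▸ hdvd) (hK ▸ htlt)
  obtain ⟨V, hVe, hV1⟩ := Submodule.exists_finrank_eq_notMem (K := K) (one_ne_zero (α := E))
    (hfin ▸ he)
  have hVcard : Nat.card V = r ^ e := by
    rw [Module.natCard_eq_pow_finrank (K := K), hVe, Nat.card_eq_fintype_card, hK]
  obtain ⟨κ, hκ, A, hA, hAprod⟩ := exists_prod_sub_eq hV1 B
  rw [hVcard] at hA hAprod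
  set M := ∑ i ∈ Finset.range m, r ^ (s * i) with hM
  have hMQ : M = ∑ i ∈ Finset.range m, (r ^ s) ^ i := by simp [hM, pow_mul]
  have hMN : M * (r ^ s - 1) + 1 = Fintype.card F := by
    have h := geom_sum_mul_add (r ^ s - 1) m
    rw [Nat.sub_add_cancel (Nat.one_le_pow _ _ (by omega)), ← hMQ, ← pow_mul, ← hF] at h
    exact h
  have hMF : (M : F) = 1 := by
    have h0 : ((r : F)) ^ s = 0 := by
      have h := Nat.cast_card_eq_zero E
      rw [hE] at h
      simpa using congrArg (algebraMap E F) h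
    obtain ⟨m', rfl⟩ : ∃ m', m = m' + 1 := ⟨m - 1, by have := hm.pos; omega⟩
    rw [hMQ, Finset.sum_range_succ']
    simp [pow_succ, h0]
  have hModd : Odd M := by
    rw [hM, Finset.odd_sum_iff_odd_card_odd]
    simpa [hr.pow] using hm
  have hAN : ∀ a ∈ A.image (algebraMap E F), a ^ (r ^ s - 1) = 1 := by
    intro a ha
    obtain ⟨a, haA, rfl⟩ := mem_image.1 ha
    obtain ⟨b, hb, hab, -⟩ := hAprod a haA
    have ha0 : a ≠ 0 := by
      rintro rfl
      have hb0 : b ≠ 0 := fun h => hB0 (h ▸ hb)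
      refine hV1 ?_
      have := V.smul_mem (-b⁻¹) hab
      rwa [zero_sub, smul_neg, neg_smul, neg_neg, Algebra.smul_def, ← map_mul,
        inv_mul_cancel₀ hb0, map_one] at this
    rw [← map_pow, ← hE, FiniteField.pow_card_sub_one_eq_one a ha0, map_one]
  obtain ⟨S, hS, hSprod⟩ := exists_pow_preimage hMN hAN
  have hinj := (algebraMap E F).injective
  rw [card_image_of_injective _ hinj, hA, hB] at hS
  have hneg : IsSquare (-1 : F) := by
    rw [FiniteField.isSquare_neg_one_iff, hF, hq4]
    decide
  have hlam' : algebraMap E F (κ * algebraMap K E lam) ≠ 0 := by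
    simpa using ⟨hκ, hlam⟩
  refine exists_isMDSSelfDual_of_isSquare_s5 ((ht.mul_right _).mul_right _)
    (Nat.mul_pos (Nat.mul_pos ht0 (pow_pos (by omega) _)) hModd.pos) hS hlam' fun x hx => ?_
  obtain ⟨hxA, hprod⟩ := hSprod x hx
  obtain ⟨a, ha, hax⟩ := mem_image.1 hxA
  obtain ⟨b, hb, -, hprodA⟩ := hAprod a ha
  have himg : ∏ c ∈ (A.image (algebraMap E F)).erase (algebraMap E F a), (algebraMap E F a - c) =
      algebraMap E F (∏ c ∈ A.erase a, (a - c)) := by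
    rw [← image_erase hinj, prod_image hinj.injOn, map_prod]
    simp
  obtain ⟨n, hn⟩ := hr.pow (n := e)
  obtain ⟨l, hl⟩ := hModd
  set D : K := ∏ c ∈ B.erase b, (b - c)
  have hsq : IsSquare (algebraMap E F (algebraMap K E (lam * D))) := by
    rcases hBsq b hb with h | h
    · exact (h.map (algebraMap K E)).map (algebraMap E F)
    · have h' := hneg.mul ((h.map (algebraMap K E)).map (algebraMap E F))
      rwa [map_neg, map_neg, neg_one_mul, neg_neg] at h'
  have key := (IsSquare.sq (algebraMap E F (κ * algebraMap K E D ^ n) * x ^ l)).mul hsq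
  rw [hprod, ← hax, himg, hprodA, hMF, hn, show M - 1 = 2 * l by omega]
  refine (congrArg IsSquare ?_).mpr key
  simp only [map_mul, map_pow]
  ring

theorem stmt_5 (r s m e t p k : ℕ) (hp : p.Prime) (hpodd : Odd p) (hr : r = p ^ k)
    (hk : 0 < k) (hs : 1 ≤ s) (hm : Odd m) (hm0 : 0 < m)
    (hq4 : r ^ (s * m) % 4 = 1)
    (ht : Even t) (hdvd : t ∣ r - 1) (ht1 : 1 < t) (ht2 : t < r - 1) (he : e ≤ s - 1)
    (F : Type*) [Field F] [Fintype F] (hF : Fintype.card F = r ^ (s * m)) :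
    ∃ C : Submodule F (Fin (t * r ^ e * ∑ i ∈ Finset.range m, r ^ (s * i)) → F),
      IsMDSSelfDual C := by
  have : Fact p.Prime := ⟨hp⟩
  have hcardF : Fintype.card F = p ^ (k * (s * m)) := by rw [hF, hr, ← pow_mul]
  have : CharP F p := charP_of_card_eq_prime_pow hcardF
  let : Algebra (ZMod p) F := ZMod.algebra F p
  have hks : k * s ≠ 0 := Nat.mul_ne_zero hk.ne' (by omega)
  have hfinF : Module.finrank (ZMod p) F = k * (s * m) := by
    have h := Module.card_eq_pow_finrank (K := ZMod p) (V := F)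
    rw [hcardF, ZMod.card] at h
    exact (Nat.pow_right_injective hp.two_le h).symm
  obtain ⟨f⟩ := FiniteField.nonempty_algHom_of_finrank_dvd (F := ZMod p) (K := GaloisField p k)
    (L := GaloisField p (k * s)) (by
      rw [GaloisField.finrank p hk.ne', GaloisField.finrank p hks]
      exact dvd_mul_right _ _)
  obtain ⟨g⟩ := FiniteField.nonempty_algHom_of_finrank_dvd (F := ZMod p)
    (K := GaloisField p (k * s)) (L := F) (by
      rw [GaloisField.finrank p hks, hfinF, ← mul_assoc]
      exact dvd_mul_right _ _)
  let := f.toRingHom.toAlgebra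
  let := g.toRingHom.toAlgebra
  let := Fintype.ofFinite (GaloisField p k)
  let := Fintype.ofFinite (GaloisField p (k * s))
  refine exists_isMDSSelfDual_of_tower (K := GaloisField p k) (E := GaloisField p (k * s))
    (hr ▸ hpodd.pow) hm ?_ ?_ hF hq4 ht (by omega) hdvd ht2 (by omega)
  · rw [Fintype.card_eq_nat_card, GaloisField.card p k hk.ne', hr]
  · rw [Fintype.card_eq_nat_card, GaloisField.card p _ hks, hr, pow_mul]
end
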